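/- arXiv:2506.11373 — 2 statements merged into one kernel-verified Lean document; each statement's English description precedes it below -/
import Mathlib

section
/- Let (Λ*, P*) be a global minimizer of the deception problem. Then P* is the stabilizing solution P_u(Λ*) (in particular symmetric positive definite), and there exists a symmetric matrix Π* ∈ ℝ^{n×n} such that: (i) (A+B_uΛ*)ᵀP* + P*(A+B_uΛ*) + Q + P* B_a R⁻¹ B_aᵀ P* = 0; (ii) (A+B_uΛ*+B_aR⁻¹B_aᵀP*)Π* + Π*(A+B_uΛ*+B_aR⁻¹B_aᵀP*)ᵀ − K̄ᵀR⁻¹B_aᵀ − B_aR⁻¹K̄ + P* B_a R⁻² B_aᵀ + B_a R⁻² B_aᵀ P* = 0; and (iii) Λ* = −Γ⁻¹ B_uᵀ P* Π*. -/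
open Matrix Filter Topology

noncomputable section

/-- A real square matrix is Hurwitz if every complex eigenvalue has strictly
negative real part. -/
def IsHurwitz {N : ℕ} (M : Matrix (Fin N) (Fin N) ℝ) : Prop :=
  ∀ μ : ℂ, μ ∈ spectrum ℂ (M.map (algebraMap ℝ ℂ)) → μ.re < 0

/-- Frobenius norm of a real matrix. -/
def frobNorm {p q : ℕ} (M : Matrix (Fin p) (Fin q) ℝ) : ℝ :=
  Real.sqrt (Matrix.trace (Mᵀ * M))

/-- Minimal eigenvalue of a (Hermitian) real matrix. -/
def eigMin {m : ℕ} (M : Matrix (Fin m) (Fin m) ℝ) : ℝ :=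
  if hM : M.IsHermitian then ⨅ i, hM.eigenvalues i else 0

/-- Maximal eigenvalue of a (Hermitian) real matrix. -/
def eigMax {m : ℕ} (M : Matrix (Fin m) (Fin m) ℝ) : ℝ :=
  if hM : M.IsHermitian then ⨆ i, hM.eigenvalues i else 0

variable {n m_u m_a : ℕ}

/-- `P` is the stabilizing solution of the spoofed ARE for the gain `Λ`. -/
def IsStabSol (A : Matrix (Fin n) (Fin n) ℝ) (Bu : Matrix (Fin n) (Fin m_u) ℝ)
    (Ba : Matrix (Fin n) (Fin m_a) ℝ) (Q : Matrix (Fin n) (Fin n) ℝ)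
    (R : Matrix (Fin m_a) (Fin m_a) ℝ)
    (Λ : Matrix (Fin m_u) (Fin n) ℝ) (P : Matrix (Fin n) (Fin n) ℝ) : Prop :=
  P.PosDef ∧
  (A + Bu * Λ)ᵀ * P + P * (A + Bu * Λ) + Q + P * Ba * R⁻¹ * Baᵀ * P = 0 ∧
  IsHurwitz (A + Bu * Λ + Ba * R⁻¹ * Baᵀ * P)

/-- `Pim` is a symmetric solution of the Lyapunov equation defining `Π(Λ)`,
given the stabilizing ARE solution `P = P_u(Λ)`. -/
def IsLyapSol (A : Matrix (Fin n) (Fin n) ℝ) (Bu : Matrix (Fin n) (Fin m_u) ℝ)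
    (Ba : Matrix (Fin n) (Fin m_a) ℝ) (R : Matrix (Fin m_a) (Fin m_a) ℝ)
    (Kbar : Matrix (Fin m_a) (Fin n) ℝ)
    (Λ : Matrix (Fin m_u) (Fin n) ℝ) (P Pim : Matrix (Fin n) (Fin n) ℝ) : Prop :=
  Pim.IsHermitian ∧
  (A + Bu * Λ + Ba * R⁻¹ * Baᵀ * P) * Pim + Pim * (A + Bu * Λ + Ba * R⁻¹ * Baᵀ * P)ᵀ
    - Kbarᵀ * R⁻¹ * Baᵀ - Ba * R⁻¹ * Kbar
    + P * Ba * (R⁻¹ * R⁻¹) * Baᵀ + Ba * (R⁻¹ * R⁻¹) * Baᵀ * P = 0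

/-- The deception cost `J̃(Λ)`, expressed through a choice function `Pu` for the
stabilizing solution of the spoofed ARE. -/
def Jcost (Ba : Matrix (Fin n) (Fin m_a) ℝ) (R : Matrix (Fin m_a) (Fin m_a) ℝ)
    (Γ : Matrix (Fin m_u) (Fin m_u) ℝ) (Kbar : Matrix (Fin m_a) (Fin n) ℝ)
    (Pu : Matrix (Fin m_u) (Fin n) ℝ → Matrix (Fin n) (Fin n) ℝ)
    (Λ : Matrix (Fin m_u) (Fin n) ℝ) : ℝ :=
  frobNorm (R⁻¹ * Baᵀ * Pu Λ - Kbar) ^ 2 + Matrix.trace (Λᵀ * Γ * Λ)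

/-- The sublevel set `S₀`. -/
def S0 (A : Matrix (Fin n) (Fin n) ℝ) (Bu : Matrix (Fin n) (Fin m_u) ℝ)
    (Ba : Matrix (Fin n) (Fin m_a) ℝ) (Q : Matrix (Fin n) (Fin n) ℝ)
    (R : Matrix (Fin m_a) (Fin m_a) ℝ) (Γ : Matrix (Fin m_u) (Fin m_u) ℝ)
    (Kbar : Matrix (Fin m_a) (Fin n) ℝ)
    (Pu : Matrix (Fin m_u) (Fin n) ℝ → Matrix (Fin n) (Fin n) ℝ) :
    Set (Matrix (Fin m_u) (Fin n) ℝ) :=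
  {Λ | (∃ P, IsStabSol A Bu Ba Q R Λ P) ∧
    Jcost Ba R Γ Kbar Pu Λ ≤ Jcost Ba R Γ Kbar Pu 0}

section MatrixNorms

open scoped Matrix.Norms.Operator

/-- The Lyapunov operator `X ↦ Mᵀ X + X M` of a Hurwitz matrix is injective. -/
lemma IsHurwitz.eq_zero_of_lyapunov {N : ℕ} {M X : Matrix (Fin N) (Fin N) ℝ} (hM : IsHurwitz M)
    (h : Mᵀ * X + X * M = 0) : X = 0 := by
  set Mc : Matrix (Fin N) (Fin N) ℂ := M.map (algebraMap ℝ ℂ) with hMc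
  set Xc : Matrix (Fin N) (Fin N) ℂ := X.map (algebraMap ℝ ℂ) with hXc
  have hc : Xc * Mc = (-Mcᵀ) * Xc := by
    have h1 : X * M = (-Mᵀ) * X := by rw [neg_mul]; exact eq_neg_of_add_eq_zero_right h
    have h2 := congrArg (fun Y : Matrix (Fin N) (Fin N) ℝ => Y.map (algebraMap ℝ ℂ)) h1
    have h3 : (-Mᵀ).map (algebraMap ℝ ℂ) = -Mcᵀ := by ext; simp [hMc]
    simpa only [Matrix.map_mul, h3] using h2
  have hp : ∀ p : Polynomial ℂ,
      Xc * Polynomial.aeval Mc p = Polynomial.aeval (-Mcᵀ) p * Xc := by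
    intro p
    induction p using Polynomial.induction_on with
    | C a => simp [Algebra.commutes]
    | add p q hp hq => simp only [map_add, mul_add, add_mul, hp, hq]
    | monomial k a ih =>
      have e : Polynomial.C a * Polynomial.X ^ (k + 1)
          = Polynomial.C a * Polynomial.X ^ k * Polynomial.X := by ring
      rw [e, map_mul (Polynomial.aeval Mc) _ Polynomial.X,
        map_mul (Polynomial.aeval (-Mcᵀ)) _ Polynomial.X, Polynomial.aeval_X, Polynomial.aeval_X,
        ← mul_assoc, ih, mul_assoc, hc, mul_assoc]
  have h0 := hp Mc.charpoly
  rw [Matrix.aeval_self_charpoly, mul_zero] at h0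
  have hu : IsUnit (Polynomial.aeval (-Mcᵀ) Mc.charpoly) := by
    by_contra hnu
    have hs : (0 : ℂ) ∈ spectrum ℂ (Polynomial.aeval (-Mcᵀ) Mc.charpoly) := by
      rwa [spectrum.zero_mem_iff]
    have : Nontrivial (Matrix (Fin N) (Fin N) ℂ) := by
      by_contra hnt
      have := not_nontrivial_iff_subsingleton.1 hnt
      exact hnu (isUnit_of_subsingleton _)
    rw [spectrum.map_polynomial_aeval] at hs
    obtain ⟨μ, hμ, hroot⟩ := hs
    have h1 : μ.re < 0 := hM μ (Matrix.mem_spectrum_iff_isRoot_charpoly.2 hroot)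
    have h2 : -μ ∈ spectrum ℂ Mcᵀ := by
      rw [← neg_neg Mcᵀ, ← spectrum.neg_eq]
      simpa using hμ
    rw [Matrix.mem_spectrum_iff_isRoot_charpoly, Matrix.charpoly_transpose,
      ← Matrix.mem_spectrum_iff_isRoot_charpoly] at h2
    have h3 := hM _ h2
    simp at h3
    linarith
  have hX0 : Xc = 0 := hu.mul_right_eq_zero.1 h0.symm
  ext i j
  have := congrFun (congrFun hX0 i) j
  simpa [hXc] using this

/-- The Lyapunov operator `X ↦ Mᵀ X + X M` of a Hurwitz matrix is surjective. -/
lemma IsHurwitz.exists_lyapunov {N : ℕ} {M : Matrix (Fin N) (Fin N) ℝ} (hM : IsHurwitz M)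
    (Y : Matrix (Fin N) (Fin N) ℝ) : ∃ X, Mᵀ * X + X * M = Y := by
  let L : Matrix (Fin N) (Fin N) ℝ →ₗ[ℝ] Matrix (Fin N) (Fin N) ℝ :=
    LinearMap.mulLeft ℝ Mᵀ + LinearMap.mulRight ℝ M
  have hinj : Function.Injective L :=
    (injective_iff_map_eq_zero L).2 fun X hX => hM.eq_zero_of_lyapunov (by simpa [L] using hX)
  obtain ⟨X, hX⟩ := LinearMap.injective_iff_surjective.1 hinj Y
  exact ⟨X, by simpa [L] using hX⟩

/-- Being Hurwitz is an open condition. -/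
lemma IsHurwitz.eventually {N : ℕ} {M : Matrix (Fin N) (Fin N) ℝ} (hM : IsHurwitz M) :
    ∀ᶠ M' in 𝓝 M, IsHurwitz M' := by
  let c : Matrix (Fin N) (Fin N) ℝ → Matrix (Fin N) (Fin N) ℂ := fun M' => M'.map (algebraMap ℝ ℂ)
  have hc : Continuous c := continuous_id.matrix_map Complex.continuous_ofReal
  let r : Matrix (Fin N) (Fin N) ℝ → ℝ := fun M' => ‖c M'‖ * ‖(1 : Matrix (Fin N) (Fin N) ℂ)‖
  have hr : Continuous r := (continuous_norm.comp hc).mul continuous_const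
  have hK : IsCompact (Metric.closedBall (0 : ℂ) (r M + 1) ∩ {μ : ℂ | 0 ≤ μ.re}) :=
    (isCompact_closedBall _ _).inter_right (isClosed_le continuous_const Complex.continuous_re)
  have key : ∀ᶠ M' in 𝓝 M, ∀ μ ∈ Metric.closedBall (0 : ℂ) (r M + 1) ∩ {μ : ℂ | 0 ≤ μ.re},
      (algebraMap ℂ (Matrix (Fin N) (Fin N) ℂ) μ - c M').det ≠ 0 := by
    refine hK.eventually_forall_of_forall_eventually fun μ hμ => ?_
    have hcont : Continuous fun z : Matrix (Fin N) (Fin N) ℝ × ℂ =>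
        (algebraMap ℂ (Matrix (Fin N) (Fin N) ℂ) z.2 - c z.1).det :=
      (((continuous_algebraMap ℂ (Matrix (Fin N) (Fin N) ℂ)).comp continuous_snd).sub
        (hc.comp continuous_fst)).matrix_det
    refine hcont.continuousAt.eventually_ne fun h0 => ?_
    have : μ ∈ spectrum ℂ (c M) := by
      rw [spectrum.mem_iff, Matrix.isUnit_iff_isUnit_det, isUnit_iff_ne_zero]
      exact fun h => h h0
    exact absurd (hM μ this) (not_lt.2 hμ.2)
  filter_upwards [key, hr.continuousAt.eventually_lt continuousAt_const (lt_add_one (r M))]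
    with M' h1 h2 μ hμ
  by_contra hre
  refine h1 μ ⟨?_, not_lt.1 hre⟩ ?_
  · rw [mem_closedBall_zero_iff]
    exact (spectrum.norm_le_norm_mul_of_mem hμ).trans h2.le
  · rw [spectrum.mem_iff, Matrix.isUnit_iff_isUnit_det, isUnit_iff_ne_zero, not_not] at hμ
    exact hμ

/-- Symmetric matrices close to a positive definite one are positive definite. -/
lemma Matrix.PosDef.eventually {N : ℕ} {P : Matrix (Fin N) (Fin N) ℝ} (hP : P.PosDef) :
    ∀ᶠ P' in 𝓝 P, P'.IsHermitian → P'.PosDef := by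
  have key : ∀ᶠ P' in 𝓝 P, ∀ x ∈ Metric.sphere (0 : Fin N → ℝ) 1, 0 < x ⬝ᵥ (P' *ᵥ x) := by
    refine (isCompact_sphere _ _).eventually_forall_of_forall_eventually fun x hx => ?_
    have hcont : Continuous fun z : Matrix (Fin N) (Fin N) ℝ × (Fin N → ℝ) =>
        z.2 ⬝ᵥ (z.1 *ᵥ z.2) :=
      continuous_snd.dotProduct (continuous_fst.matrix_mulVec continuous_snd)
    refine continuousAt_const.eventually_lt hcont.continuousAt ?_
    have hx0 : x ≠ 0 := ne_zero_of_mem_unit_sphere ⟨x, hx⟩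
    simpa using hP.dotProduct_mulVec_pos hx0
  filter_upwards [key] with P' h hH
  refine Matrix.PosDef.of_dotProduct_mulVec_pos hH fun x hx => ?_
  have hn : 0 < ‖x‖ := norm_pos_iff.2 hx
  have h1 := h (‖x‖⁻¹ • x) (by simp [norm_smul, hn.ne'])
  rw [Matrix.mulVec_smul, smul_dotProduct, dotProduct_smul, smul_smul, smul_eq_mul] at h1
  simpa using (pos_iff_pos_of_mul_pos h1).1 (by positivity)

/-- Strict derivative of an inhomogeneous quadratic map in finite dimension. -/
lemma hasStrictFDerivAt_quadratic {E F : Type*} [NormedAddCommGroup E] [NormedSpace ℝ E]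
    [FiniteDimensional ℝ E] [NormedAddCommGroup F] [NormedSpace ℝ F] [FiniteDimensional ℝ F]
    (b : F) (l : E →ₗ[ℝ] F) (B : E →ₗ[ℝ] E →ₗ[ℝ] F) (x : E) :
    HasStrictFDerivAt (fun y => b + l y + B y y)
      (LinearMap.toContinuousLinearMap (l + B x + B.flip x)) x := by
  have h1 := (LinearMap.toContinuousLinearMap l).hasStrictFDerivAt (x := x)
  have h2 := B.toContinuousBilinearMap.isBoundedBilinearMap.hasStrictFDerivAt (x, x)
  have h3 := HasStrictFDerivAt.comp (f := fun y : E => (y, y)) x h2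
    ((hasStrictFDerivAt_id x).prodMk (hasStrictFDerivAt_id x))
  convert! ((hasStrictFDerivAt_const b x).add h1).add h3 using 1
  ext v
  simp [add_assoc]

/-- Every linear functional on matrices is of the form `X ↦ tr (M X)`. -/
lemma exists_trace_mul_eq {p q : ℕ} (ℓ : Matrix (Fin p) (Fin q) ℝ →ₗ[ℝ] ℝ) :
    ∃ M : Matrix (Fin q) (Fin p) ℝ, ∀ X, ℓ X = Matrix.trace (M * X) := by
  refine ⟨Matrix.of fun j i => ℓ (Matrix.single i j 1), fun X => ?_⟩
  conv_lhs => rw [Matrix.matrix_eq_sum_single X]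
  have h : ∀ i j, Matrix.single i j (X i j) = X i j • Matrix.single i j (1 : ℝ) := by
    intro i j; simp
  simp only [map_sum, h, map_smul, Matrix.trace, Matrix.diag, Matrix.mul_apply, Matrix.of_apply,
    smul_eq_mul]
  rw [Finset.sum_comm]
  exact Finset.sum_congr rfl fun _ _ => Finset.sum_congr rfl fun _ _ => mul_comm _ _

lemma frobNorm_sq {p q : ℕ} (M : Matrix (Fin p) (Fin q) ℝ) :
    frobNorm M ^ 2 = Matrix.trace (Mᵀ * M) := by
  refine Real.sq_sqrt ?_
  simp only [Matrix.trace, Matrix.diag, Matrix.mul_apply, Matrix.transpose_apply]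
  exact Finset.sum_nonneg fun _ _ => Finset.sum_nonneg fun _ _ => mul_self_nonneg _

/-- First-order (Lagrange) conditions at a global minimizer over stabilizing solutions, with
`S = B_a R⁻¹ B_aᵀ`, `T = R⁻¹ B_aᵀ`. -/
lemma exists_lagrange_multiplier
    (A : Matrix (Fin n) (Fin n) ℝ) (Bu : Matrix (Fin n) (Fin m_u) ℝ)
    (S Q : Matrix (Fin n) (Fin n) ℝ) (hS : Sᵀ = S) (hQ : Qᵀ = Q)
    (T : Matrix (Fin m_a) (Fin n) ℝ) (Γ : Matrix (Fin m_u) (Fin m_u) ℝ) (hΓ : Γᵀ = Γ)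
    (K : Matrix (Fin m_a) (Fin n) ℝ)
    (Λs : Matrix (Fin m_u) (Fin n) ℝ) (Ps : Matrix (Fin n) (Fin n) ℝ) (hP : Ps.PosDef)
    (hare : (A + Bu * Λs)ᵀ * Ps + Ps * (A + Bu * Λs) + Q + Ps * S * Ps = 0)
    (hH : IsHurwitz (A + Bu * Λs + S * Ps))
    (hmin : ∀ (Λ : Matrix (Fin m_u) (Fin n) ℝ) (P : Matrix (Fin n) (Fin n) ℝ), P.PosDef →
      (A + Bu * Λ)ᵀ * P + P * (A + Bu * Λ) + Q + P * S * P = 0 → IsHurwitz (A + Bu * Λ + S * P) →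
      frobNorm (T * Ps - K) ^ 2 + Matrix.trace (Λsᵀ * Γ * Λs) ≤
        frobNorm (T * P - K) ^ 2 + Matrix.trace (Λᵀ * Γ * Λ)) :
    ∃ Y : Matrix (Fin n) (Fin n) ℝ,
      Y * (A + Bu * Λs + S * Ps)ᵀ + (A + Bu * Λs + S * Ps) * Y
        + (2 : ℝ) • ((T * Ps - K)ᵀ * T) = 0 ∧
      (2 : ℝ) • (Γ * Λs) + Buᵀ * Ps * (Y + Yᵀ) = 0 := by
  have hPt : Psᵀ = Ps := by simpa using hP.isHermitian.eq
  let f : Matrix (Fin m_u) (Fin n) ℝ × Matrix (Fin n) (Fin n) ℝ → Matrix (Fin n) (Fin n) ℝ := fun z =>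
    (A + Bu * z.1)ᵀ * z.2 + z.2 * (A + Bu * z.1) + Q + z.2 * S * z.2
  let φ : Matrix (Fin m_u) (Fin n) ℝ × Matrix (Fin n) (Fin n) ℝ → ℝ := fun z =>
    frobNorm (T * z.2 - K) ^ 2 + Matrix.trace (z.1ᵀ * Γ * z.1)
  have hextr : IsLocalExtrOn φ {z | f z = f (Λs, Ps)} (Λs, Ps) := by
    left
    have hf0 : f (Λs, Ps) = 0 := hare
    have hcont : Continuous fun z : Matrix (Fin m_u) (Fin n) ℝ × Matrix (Fin n) (Fin n) ℝ =>
        A + Bu * z.1 + S * z.2 := by fun_prop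
    have e1 : ∀ᶠ z in 𝓝 (Λs, Ps), IsHurwitz (A + Bu * z.1 + S * z.2) :=
      hcont.continuousAt.eventually hH.eventually
    have e2 : ∀ᶠ z in 𝓝 (Λs, Ps), z.2.IsHermitian → z.2.PosDef :=
      (continuousAt_snd (p := (Λs, Ps))).eventually hP.eventually
    filter_upwards [nhdsWithin_le_nhds e1, nhdsWithin_le_nhds e2, self_mem_nhdsWithin]
      with z h1 h2 h3
    obtain ⟨Λ, P⟩ := z
    have h4 : (A + Bu * Λ)ᵀ * P + P * (A + Bu * Λ) + Q + P * S * P = 0 :=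
      Eq.trans (show f (Λ, P) = f (Λs, Ps) from h3) hf0
    have h5 : (A + Bu * Λ)ᵀ * Pᵀ + Pᵀ * (A + Bu * Λ) + Q + Pᵀ * S * Pᵀ = 0 := by
      have := congrArg Matrix.transpose h4
      simp only [Matrix.transpose_add, Matrix.transpose_mul, Matrix.transpose_transpose, hS, hQ,
        Matrix.transpose_zero] at this
      rw [← this]
      simp only [Matrix.transpose_add, Matrix.transpose_mul, Matrix.mul_assoc]
      abel
    have h6 : P - Pᵀ = 0 := by
      refine h1.eq_zero_of_lyapunov ?_
      have h7 := congrArg₂ (fun U V => U - V) h4 h5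
      simp only [sub_zero] at h7
      rw [← h7]
      simp only [Matrix.transpose_add, Matrix.transpose_mul, hS]
      noncomm_ring
    have hsym : P.IsHermitian := by
      rw [Matrix.IsHermitian, Matrix.conjTranspose_eq_transpose_of_trivial]
      exact (sub_eq_zero.1 h6).symm
    exact hmin Λ P (h2 hsym) h4 h1
  let lf : (Matrix (Fin m_u) (Fin n) ℝ × Matrix (Fin n) (Fin n) ℝ) →ₗ[ℝ] Matrix (Fin n) (Fin n) ℝ :=
    { toFun := fun z => Aᵀ * z.2 + z.2 * A
      map_add' := fun x y => by simp only [Prod.snd_add]; noncomm_ring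
      map_smul' := fun c x => by simp }
  let Bf : (Matrix (Fin m_u) (Fin n) ℝ × Matrix (Fin n) (Fin n) ℝ) →ₗ[ℝ]
      (Matrix (Fin m_u) (Fin n) ℝ × Matrix (Fin n) (Fin n) ℝ) →ₗ[ℝ] Matrix (Fin n) (Fin n) ℝ :=
    LinearMap.mk₂ ℝ (fun x y => (Bu * x.1)ᵀ * y.2 + y.2 * (Bu * x.1) + x.2 * S * y.2)
      (fun x x' y => by
        simp only [Prod.fst_add, Prod.snd_add, Matrix.mul_add, Matrix.add_mul,
          Matrix.transpose_add]; abel)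
      (fun c x y => by simp)
      (fun x y y' => by simp only [Prod.snd_add, Matrix.mul_add, Matrix.add_mul]; abel)
      (fun c x y => by simp)
  have hf := hasStrictFDerivAt_quadratic Q lf Bf (Λs, Ps)
  have hfe : f = fun y => Q + lf y + Bf y y := by
    funext z
    simp only [f, lf, Bf, LinearMap.mk₂_apply, LinearMap.coe_mk, AddHom.coe_mk,
      Matrix.transpose_add, Matrix.add_mul, Matrix.mul_add]
    abel
  rw [← hfe] at hf
  let lφ : (Matrix (Fin m_u) (Fin n) ℝ × Matrix (Fin n) (Fin n) ℝ) →ₗ[ℝ] ℝ :=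
    { toFun := fun z => -(2 * Matrix.trace (Kᵀ * (T * z.2)))
      map_add' := fun x y => by
        simp only [Prod.snd_add, Matrix.mul_add, Matrix.trace_add]; ring
      map_smul' := fun c x => by simp; ring }
  let Bφ : (Matrix (Fin m_u) (Fin n) ℝ × Matrix (Fin n) (Fin n) ℝ) →ₗ[ℝ]
      (Matrix (Fin m_u) (Fin n) ℝ × Matrix (Fin n) (Fin n) ℝ) →ₗ[ℝ] ℝ :=
    LinearMap.mk₂ ℝ (fun x y => Matrix.trace ((T * x.2)ᵀ * (T * y.2))
        + Matrix.trace (x.1ᵀ * Γ * y.1))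
      (fun x x' y => by
        simp only [Prod.fst_add, Prod.snd_add, Matrix.mul_add, Matrix.add_mul,
          Matrix.transpose_add, Matrix.trace_add]; ring)
      (fun c x y => by simp; ring)
      (fun x y y' => by
        simp only [Prod.fst_add, Prod.snd_add, Matrix.mul_add, Matrix.trace_add]; ring)
      (fun c x y => by simp; ring)
  have hφ := hasStrictFDerivAt_quadratic (Matrix.trace (Kᵀ * K)) lφ Bφ (Λs, Ps)
  have hφe : φ = fun y => Matrix.trace (Kᵀ * K) + lφ y + Bφ y y := by
    funext z
    have ht : Matrix.trace ((T * z.2)ᵀ * K) = Matrix.trace (Kᵀ * (T * z.2)) := by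
      rw [← Matrix.trace_transpose, Matrix.transpose_mul, Matrix.transpose_transpose]
    simp only [φ, lφ, Bφ, LinearMap.mk₂_apply, LinearMap.coe_mk, AddHom.coe_mk, frobNorm_sq,
      Matrix.transpose_sub, Matrix.sub_mul, Matrix.mul_sub, Matrix.trace_sub, ht]
    ring
  rw [← hφe] at hφ
  obtain ⟨ℓ, c, hne, hmul⟩ := hextr.exists_linear_map_of_hasStrictFDerivAt hf hφ
  obtain ⟨Z, hZ⟩ := exists_trace_mul_eq ℓ
  have hf' : ∀ x : Matrix (Fin m_u) (Fin n) ℝ × Matrix (Fin n) (Fin n) ℝ,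
      (lf + Bf (Λs, Ps) + Bf.flip (Λs, Ps)) x =
      ((A + Bu * Λs + S * Ps)ᵀ * x.2 + x.2 * (A + Bu * Λs + S * Ps))
        + ((Bu * x.1)ᵀ * Ps + Ps * (Bu * x.1)) := by
    intro x
    simp only [lf, Bf, LinearMap.mk₂_apply, LinearMap.coe_mk, AddHom.coe_mk, LinearMap.add_apply,
      LinearMap.flip_apply, Matrix.transpose_add, Matrix.transpose_mul, Matrix.add_mul,
      Matrix.mul_add, hS, hPt, Matrix.mul_assoc]
    abel
  have hφ' : ∀ x : Matrix (Fin m_u) (Fin n) ℝ × Matrix (Fin n) (Fin n) ℝ,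
      (lφ + Bφ (Λs, Ps) + Bφ.flip (Λs, Ps)) x =
      2 * Matrix.trace ((T * Ps - K)ᵀ * T * x.2) + 2 * Matrix.trace ((Γ * Λs)ᵀ * x.1) := by
    intro x
    have t1 : Matrix.trace ((T * x.2)ᵀ * (T * Ps)) = Matrix.trace ((T * Ps)ᵀ * (T * x.2)) := by
      rw [← Matrix.trace_transpose, Matrix.transpose_mul, Matrix.transpose_transpose]
    have t2 : Matrix.trace (x.1ᵀ * (Γ * Λs)) = Matrix.trace (Λsᵀ * (Γ * x.1)) := by
      rw [← Matrix.trace_transpose]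
      simp only [Matrix.transpose_mul, Matrix.transpose_transpose, hΓ, Matrix.mul_assoc]
    simp only [lφ, Bφ, LinearMap.mk₂_apply, LinearMap.coe_mk, AddHom.coe_mk, LinearMap.add_apply,
      LinearMap.flip_apply, t1, Matrix.transpose_sub, Matrix.sub_mul, Matrix.trace_sub,
      Matrix.mul_assoc, Matrix.transpose_mul Γ, hΓ, t2]
    ring
  have hmul' : ∀ x : Matrix (Fin m_u) (Fin n) ℝ × Matrix (Fin n) (Fin n) ℝ,
      Matrix.trace (Z * (((A + Bu * Λs + S * Ps)ᵀ * x.2 + x.2 * (A + Bu * Λs + S * Ps))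
        + ((Bu * x.1)ᵀ * Ps + Ps * (Bu * x.1))))
      + c * (2 * Matrix.trace ((T * Ps - K)ᵀ * T * x.2)
        + 2 * Matrix.trace ((Γ * Λs)ᵀ * x.1)) = 0 := by
    intro x
    rw [← hf', ← hφ', ← hZ]
    exact hmul x
  have hc : c ≠ 0 := by
    rintro rfl
    apply hne
    rw [Prod.mk_eq_zero]
    refine ⟨LinearMap.ext fun W => ?_, rfl⟩
    obtain ⟨X, hX⟩ := hH.exists_lyapunov W
    have := hmul' (0, X)
    simp only [hX] at this
    simpa [hZ] using this
  refine ⟨c⁻¹ • Z, ?_, ?_⟩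
  · rw [Matrix.ext_iff_trace_mul_right]
    intro X
    have h := hmul' (0, X)
    have h1 : Matrix.trace (Z * X * (A + Bu * Λs + S * Ps))
        = Matrix.trace ((A + Bu * Λs + S * Ps) * Z * X) := by
      rw [Matrix.trace_mul_comm, Matrix.mul_assoc]
    simp only [Matrix.mul_zero, Matrix.transpose_zero, Matrix.zero_mul, add_zero,
      Matrix.trace_zero, Matrix.mul_add Z, Matrix.trace_add, ← Matrix.mul_assoc Z, h1] at h
    simp only [Matrix.add_mul _ _ X, Matrix.smul_mul, Matrix.mul_smul, Matrix.trace_add,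
      Matrix.trace_smul, smul_eq_mul, Matrix.zero_mul, Matrix.trace_zero]
    field_simp
    linear_combination h
  · rw [← Matrix.transpose_inj, Matrix.ext_iff_trace_mul_right]
    intro X
    have h := hmul' (X, 0)
    have h1 : Matrix.trace (Z * (Bu * X)ᵀ * Ps) = Matrix.trace (Zᵀ * Ps * Bu * X) := by
      rw [← Matrix.trace_transpose]
      simp only [Matrix.transpose_mul, Matrix.transpose_transpose, hPt]
      rw [Matrix.trace_mul_comm Ps, Matrix.mul_assoc, Matrix.trace_mul_comm (Bu * X)]
      simp only [Matrix.mul_assoc]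
    simp only [Matrix.mul_zero, Matrix.zero_mul, add_zero, zero_add,
      Matrix.trace_zero, Matrix.mul_add Z, Matrix.trace_add, ← Matrix.mul_assoc, h1] at h
    simp only [Matrix.transpose_add, Matrix.transpose_smul, Matrix.transpose_mul _ (_ + _),
      Matrix.transpose_mul Buᵀ, Matrix.transpose_transpose, hPt, Matrix.transpose_zero,
      Matrix.add_mul, Matrix.smul_mul, Matrix.trace_add,
      Matrix.trace_smul, smul_eq_mul, Matrix.zero_mul, Matrix.trace_zero, ← Matrix.mul_assoc]
    field_simp
    linear_combination h

end MatrixNorms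

/-- Theorem 1: KKT conditions at a global minimizer of the
deception problem. -/
theorem stmt1
    (A : Matrix (Fin n) (Fin n) ℝ) (Bu : Matrix (Fin n) (Fin m_u) ℝ)
    (Ba : Matrix (Fin n) (Fin m_a) ℝ)
    (Q : Matrix (Fin n) (Fin n) ℝ) (R : Matrix (Fin m_a) (Fin m_a) ℝ)
    (Γ : Matrix (Fin m_u) (Fin m_u) ℝ)
    (hQ : Q.PosDef) (hR : R.PosDef) (hΓ : Γ.PosDef)
    (Kbar : Matrix (Fin m_a) (Fin n) ℝ)
    (Λs : Matrix (Fin m_u) (Fin n) ℝ) (Ps : Matrix (Fin n) (Fin n) ℝ)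
    (hfeas : IsStabSol A Bu Ba Q R Λs Ps)
    (hmin : ∀ Λ P, IsStabSol A Bu Ba Q R Λ P →
      frobNorm (R⁻¹ * Baᵀ * Ps - Kbar) ^ 2 + Matrix.trace (Λsᵀ * Γ * Λs) ≤
        frobNorm (R⁻¹ * Baᵀ * P - Kbar) ^ 2 + Matrix.trace (Λᵀ * Γ * Λ)) :
    Ps.PosDef ∧
    ∃ Pim : Matrix (Fin n) (Fin n) ℝ, Pim.IsHermitian ∧
      (A + Bu * Λs)ᵀ * Ps + Ps * (A + Bu * Λs) + Q + Ps * Ba * R⁻¹ * Baᵀ * Ps = 0 ∧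
      (A + Bu * Λs + Ba * R⁻¹ * Baᵀ * Ps) * Pim
        + Pim * (A + Bu * Λs + Ba * R⁻¹ * Baᵀ * Ps)ᵀ
        - Kbarᵀ * R⁻¹ * Baᵀ - Ba * R⁻¹ * Kbar
        + Ps * Ba * (R⁻¹ * R⁻¹) * Baᵀ + Ba * (R⁻¹ * R⁻¹) * Baᵀ * Ps = 0 ∧
      Λs = -(Γ⁻¹ * Buᵀ * Ps * Pim) := by
  obtain ⟨hP, hare, hH⟩ := hfeas
  have hRt : (R⁻¹)ᵀ = R⁻¹ := by simpa using hR.inv.isHermitian.eq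
  have hQt : Qᵀ = Q := by simpa using hQ.isHermitian.eq
  have hΓt : Γᵀ = Γ := by simpa using hΓ.isHermitian.eq
  have hPt : Psᵀ = Ps := by simpa using hP.isHermitian.eq
  obtain ⟨Y, hY1, hY2⟩ := exists_lagrange_multiplier A Bu (Ba * R⁻¹ * Baᵀ) Q
    (by simp only [Matrix.transpose_mul, Matrix.transpose_transpose, hRt, Matrix.mul_assoc]) hQt
    (R⁻¹ * Baᵀ) Γ hΓt Kbar Λs Ps hP (by simpa only [Matrix.mul_assoc] using hare) hH
    (fun Λ P h1 h2 h3 => hmin Λ P ⟨h1, by simpa only [Matrix.mul_assoc] using h2, h3⟩)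
  refine ⟨hP, (1 / 2 : ℝ) • (Y + Yᵀ), ?_, hare, ?_, ?_⟩
  · rw [Matrix.IsHermitian, Matrix.conjTranspose_eq_transpose_of_trivial, Matrix.transpose_smul,
      Matrix.transpose_add, Matrix.transpose_transpose, add_comm]
  · have hY3 := congrArg Matrix.transpose hY1
    set M := A + Bu * Λs + Ba * R⁻¹ * Baᵀ * Ps
    simp only [Matrix.transpose_add, Matrix.transpose_mul, Matrix.transpose_smul,
      Matrix.transpose_transpose, Matrix.transpose_zero, Matrix.transpose_sub, hRt, hPt,
      Matrix.sub_mul, Matrix.mul_assoc] at hY1 hY3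
    simp only [Matrix.mul_smul, Matrix.smul_mul, Matrix.mul_add, Matrix.add_mul, Matrix.mul_assoc]
    linear_combination (norm := module) (1 / 2 : ℝ) • hY1 + (1 / 2 : ℝ) • hY3
  · have hu : IsUnit Γ.det := (Matrix.isUnit_iff_isUnit_det Γ).1 hΓ.isUnit
    have h1 : Γ * Λs = -(Buᵀ * Ps * ((1 / 2 : ℝ) • (Y + Yᵀ))) := by
      rw [Matrix.mul_smul]
      linear_combination (norm := module) (1 / 2 : ℝ) • hY2
    calc Λs = Γ⁻¹ * (Γ * Λs) := by rw [← Matrix.mul_assoc, Matrix.nonsing_inv_mul _ hu,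
            Matrix.one_mul]
      _ = _ := by rw [h1, Matrix.mul_neg]; simp only [Matrix.mul_assoc]
end
end

section
/- Assume there is ε ∈ (0,1) with ‖K* − K̄‖_F ≤ (ε/2)·√(λ_min(Γ)) / (√(λ_min(Γ))·‖S B_a‖_F + ‖S B_u‖_F). Then there exist finite constants P̄ > 0 and Π̄ > 0 such that ‖P_u(Λ)‖_F ≤ P̄ and ‖Π(Λ)‖_F ≤ Π̄ for all Λ ∈ S₀. -/
open Matrix Filter Topology

noncomputable section

variable {n m_u m_a : ℕ}

section Frobenius

attribute [local instance] Matrix.frobeniusNormedAddCommGroup Matrix.frobeniusNormedSpace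

theorem frobenius_norm_sq_eq_trace {p q : ℕ} (M : Matrix (Fin p) (Fin q) ℝ) :
    ‖M‖ ^ 2 = Matrix.trace (Mᵀ * M) := by
  rw [Matrix.frobenius_norm_def, ← Real.sqrt_eq_rpow, Real.sq_sqrt (by positivity),
    Finset.sum_comm]
  simp [Matrix.trace, Matrix.mul_apply, sq]

theorem frobNorm_eq_norm {p q : ℕ} (M : Matrix (Fin p) (Fin q) ℝ) : frobNorm M = ‖M‖ := by
  rw [frobNorm, ← frobenius_norm_sq_eq_trace, Real.sqrt_sq (norm_nonneg _)]

theorem trace_transpose_mul_le_norm {p q : ℕ} (M N : Matrix (Fin p) (Fin q) ℝ) :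
    Matrix.trace (Mᵀ * N) ≤ ‖M‖ * ‖N‖ := by
  have expand (X Y : Matrix (Fin p) (Fin q) ℝ) :
      Matrix.trace (Xᵀ * Y) = ∑ i : Fin q × Fin p, X i.2 i.1 * Y i.2 i.1 := by
    simp [Matrix.trace, Matrix.mul_apply, Fintype.sum_prod_type]
  refine le_of_sq_le_sq ?_ (by positivity)
  rw [mul_pow, frobenius_norm_sq_eq_trace, frobenius_norm_sq_eq_trace, expand, expand, expand]
  simp_rw [← sq]
  exact Finset.sum_mul_sq_le_sq_mul_sq _ _ _

theorem dotProduct_mulVec_le_norm {p : ℕ} (F : Matrix (Fin p) (Fin p) ℝ) (x : Fin p → ℝ) :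
    x ⬝ᵥ (F *ᵥ x) ≤ ‖F‖ * (x ⬝ᵥ x) := by
  have hnorm : ‖Matrix.vecMulVec x x‖ = x ⬝ᵥ x := by
    rw [← frobNorm_eq_norm, frobNorm, Matrix.transpose_vecMulVec, Matrix.vecMulVec_mul_vecMulVec,
      Matrix.trace_vecMulVec, dotProduct_smul, smul_eq_mul, Real.sqrt_mul_self]
    simpa using dotProduct_star_self_nonneg x
  have h := trace_transpose_mul_le_norm (Matrix.vecMulVec x x) F
  rw [hnorm, Matrix.transpose_vecMulVec, Matrix.vecMulVec_mul, Matrix.trace_vecMulVec] at h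
  rw [Matrix.dotProduct_mulVec]
  linarith [dotProduct_comm x (x ᵥ* F)]

theorem posSemidef_smul_one_sub_add_transpose {p : ℕ} (F : Matrix (Fin p) (Fin p) ℝ) {c : ℝ}
    (hF : 2 * ‖F‖ ≤ c) : (c • (1 : Matrix (Fin p) (Fin p) ℝ) - (Fᵀ + F)).PosSemidef := by
  refine Matrix.PosSemidef.of_dotProduct_mulVec_nonneg ?_ fun x ↦ ?_
  · simp [Matrix.IsHermitian, Matrix.conjTranspose_eq_transpose_of_trivial, add_comm]
  · have h1 := dotProduct_mulVec_le_norm F x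
    have h2 : x ⬝ᵥ (Fᵀ *ᵥ x) = x ⬝ᵥ (F *ᵥ x) := by
      rw [Matrix.mulVec_transpose, dotProduct_comm, Matrix.dotProduct_mulVec]
    have h3 : 0 ≤ x ⬝ᵥ x := by simpa using dotProduct_star_self_nonneg x
    have h4 := mul_le_mul_of_nonneg_right hF h3
    simp only [star_trivial, Matrix.sub_mulVec, Matrix.add_mulVec, Matrix.smul_mulVec,
      Matrix.one_mulVec, dotProduct_sub, dotProduct_add, dotProduct_smul, smul_eq_mul, h2]
    linarith

theorem posSemidef_sub_eigMin {p : ℕ} {M : Matrix (Fin p) (Fin p) ℝ} (hM : M.IsHermitian) :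
    (M - eigMin M • (1 : Matrix (Fin p) (Fin p) ℝ)).PosSemidef := by
  have hle (i) : eigMin M ≤ hM.eigenvalues i := by
    rw [eigMin, dif_pos hM]
    exact ciInf_le (Set.finite_range _).bddBelow i
  generalize eigMin M = c at hle ⊢
  have hD : (Matrix.diagonal fun i ↦ hM.eigenvalues i - c).PosSemidef :=
    Matrix.PosSemidef.diagonal fun i ↦ sub_nonneg.2 (hle i)
  have h := hD.mul_mul_conjTranspose_same (hM.eigenvectorUnitary : Matrix (Fin p) (Fin p) ℝ)
  convert h using 1
  conv_lhs => rw [hM.spectral_theorem]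
  have hU : (hM.eigenvectorUnitary : Matrix (Fin p) (Fin p) ℝ) *
      (hM.eigenvectorUnitary : Matrix (Fin p) (Fin p) ℝ)ᴴ = 1 :=
    Unitary.coe_mul_star_self hM.eigenvectorUnitary
  rw [Unitary.conjStarAlgAut_apply, ← Matrix.diagonal_sub, Matrix.mul_sub, Matrix.sub_mul,
    ← Matrix.smul_one_eq_diagonal, Matrix.mul_smul, Matrix.smul_mul, Matrix.mul_one, hU]
  rfl

theorem eigMin_pos {p : ℕ} [Nonempty (Fin p)] {M : Matrix (Fin p) (Fin p) ℝ} (hM : M.PosDef) :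
    0 < eigMin M := by
  rw [eigMin, dif_pos hM.1]
  obtain ⟨i, hi⟩ := exists_eq_ciInf_of_finite (f := hM.1.eigenvalues)
  rw [← hi]
  exact hM.eigenvalues_pos i

theorem Matrix.PosDef.exists_posSemidef_sub_smul_one {p : ℕ} {M : Matrix (Fin p) (Fin p) ℝ}
    (hM : M.PosDef) : ∃ c : ℝ, 0 < c ∧
    (M - c • (1 : Matrix (Fin p) (Fin p) ℝ)).PosSemidef := by
  rcases isEmpty_or_nonempty (Fin p) with hp | hp
  · refine ⟨1, one_pos, ?_⟩
    rw [Subsingleton.elim (M - _) 0]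
    exact Matrix.PosSemidef.zero
  · exact ⟨eigMin M, eigMin_pos hM, posSemidef_sub_eigMin hM.1⟩

open scoped MatrixOrder in
theorem Matrix.PosSemidef.trace_mul_nonneg {p : ℕ} {M N : Matrix (Fin p) (Fin p) ℝ}
    (hM : M.PosSemidef) (hN : N.PosSemidef) : 0 ≤ Matrix.trace (M * N) := by
  obtain ⟨B, rfl⟩ := CStarAlgebra.nonneg_iff_eq_star_mul_self.1 hM.nonneg
  rw [Matrix.star_eq_conjTranspose]
  rw [Matrix.mul_assoc, Matrix.trace_mul_comm]
  exact (hN.mul_mul_conjTranspose_same B).trace_nonneg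

theorem mul_norm_sq_le_trace {p q : ℕ} {M : Matrix (Fin p) (Fin p) ℝ} {c : ℝ}
    (hM : (M - c • (1 : Matrix (Fin p) (Fin p) ℝ)).PosSemidef) (X : Matrix (Fin p) (Fin q) ℝ) :
    c * ‖X‖ ^ 2 ≤ Matrix.trace (Xᵀ * M * X) := by
  have h := (hM.conjTranspose_mul_mul_same X).trace_nonneg
  rw [Matrix.conjTranspose_eq_transpose_of_trivial, Matrix.mul_sub, Matrix.sub_mul,
    Matrix.trace_sub] at h
  rw [frobenius_norm_sq_eq_trace]
  simpa using h

/-- A dissipation inequality for `S` bounds the solutions of the Lyapunov equation in terms of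
its right-hand side, uniformly in the coefficient matrix. -/
theorem lyapunov_solution_norm_le {p : ℕ} {S M X V : Matrix (Fin p) (Fin p) ℝ} {s η : ℝ}
    (hs : 0 < s) (hη : 0 < η) (hS : S.PosSemidef)
    (hsS : (S - s • (1 : Matrix (Fin p) (Fin p) ℝ)).PosSemidef)
    (hM : (-(Mᵀ * S + S * M) - η • (1 : Matrix (Fin p) (Fin p) ℝ)).PosSemidef)
    (hX : Xᵀ = X) (hV : M * X + X * Mᵀ = V) :
    ‖X‖ ≤ ‖S‖ ^ 2 * ‖V‖ / (η * s) := by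
  set G := -(Mᵀ * S + S * M) with hG
  have hSt : Sᵀ = S := hS.1
  have h1 : 0 ≤ Matrix.trace (S * (X * (G - η • (1 : Matrix (Fin p) (Fin p) ℝ)) * X)) := by
    refine hS.trace_mul_nonneg ?_
    have := hM.conjTranspose_mul_mul_same X
    rwa [Matrix.conjTranspose_eq_transpose_of_trivial, hX] at this
  have h2 : s * ‖X‖ ^ 2 ≤ Matrix.trace (S * (X * X)) := by
    have := mul_norm_sq_le_trace hsS X
    rwa [hX, Matrix.mul_assoc, Matrix.trace_mul_comm, Matrix.mul_assoc] at this
  have h3 : Matrix.trace (S * (X * (G - η • (1 : Matrix (Fin p) (Fin p) ℝ)) * X)) =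
      Matrix.trace (S * (X * G * X)) - η * Matrix.trace (S * (X * X)) := by
    simp [Matrix.mul_sub, Matrix.sub_mul]
  have h4 : Matrix.trace (S * (X * G * X)) = -Matrix.trace ((S * X * S)ᵀ * V) := by
    have e1 : Matrix.trace (S * X * S * (X * Mᵀ)) = Matrix.trace (S * (X * (Mᵀ * S) * X)) := by
      rw [show S * X * S * (X * Mᵀ) = (S * X) * (S * X * Mᵀ) by simp only [Matrix.mul_assoc],
        Matrix.trace_mul_comm,
        show S * X * Mᵀ * (S * X) = S * (X * (Mᵀ * S) * X) by simp only [Matrix.mul_assoc]]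
    have e2 : S * X * S * (M * X) = S * (X * (S * M) * X) := by simp only [Matrix.mul_assoc]
    rw [← hV, Matrix.transpose_mul, Matrix.transpose_mul, hX, hSt, ← Matrix.mul_assoc S X S,
      Matrix.mul_add, Matrix.trace_add, e1, e2, hG]
    simp only [Matrix.mul_neg, Matrix.neg_mul, Matrix.mul_add, Matrix.add_mul, Matrix.trace_neg,
      Matrix.trace_add]
    ring
  have h5 : -Matrix.trace ((S * X * S)ᵀ * V) ≤ ‖S * X * S‖ * ‖V‖ := by
    have := trace_transpose_mul_le_norm (S * X * S) (-V)
    simpa using this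
  have h6 : ‖S * X * S‖ ≤ ‖S‖ * ‖X‖ * ‖S‖ :=
    (Matrix.frobenius_norm_mul _ _).trans
      (mul_le_mul_of_nonneg_right (Matrix.frobenius_norm_mul _ _) (norm_nonneg _))
  have h7 : η * s * ‖X‖ * ‖X‖ ≤ ‖S‖ ^ 2 * ‖V‖ * ‖X‖ := by
    nlinarith [mul_le_mul_of_nonneg_left h2 hη.le,
      mul_le_mul_of_nonneg_right h6 (norm_nonneg V)]
  rw [le_div_iff₀ (by positivity)]
  rcases (norm_nonneg X).eq_or_lt with h0 | h0
  · rw [← h0, zero_mul]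
    positivity
  · linarith [le_of_mul_le_mul_right h7 h0]

/-- The dissipation inequality passes from `S` and `M` to `S⁻¹` and `Mᵀ`. -/
theorem posSemidef_lyapunov_inv {p : ℕ} {S M : Matrix (Fin p) (Fin p) ℝ} {t η : ℝ}
    (hη : 0 ≤ η) (hS : S.PosDef)
    (ht : (S⁻¹ * S⁻¹ - t • (1 : Matrix (Fin p) (Fin p) ℝ)).PosSemidef)
    (hM : (-(Mᵀ * S + S * M) - η • (1 : Matrix (Fin p) (Fin p) ℝ)).PosSemidef) :
    (-(Mᵀᵀ * S⁻¹ + S⁻¹ * Mᵀ) - (η * t) • (1 : Matrix (Fin p) (Fin p) ℝ)).PosSemidef := by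
  have hdet : IsUnit S.det := (Matrix.isUnit_iff_isUnit_det _).1 hS.isUnit
  have h := (hM.mul_mul_conjTranspose_same S⁻¹).add (ht.smul hη)
  convert h using 1
  rw [hS.inv.1.eq, Matrix.transpose_transpose]
  have e1 : S⁻¹ * (Mᵀ * S) * S⁻¹ = S⁻¹ * Mᵀ := by
    rw [Matrix.mul_assoc, Matrix.mul_assoc, Matrix.mul_nonsing_inv _ hdet, Matrix.mul_one]
  have e2 : S⁻¹ * (S * M) * S⁻¹ = M * S⁻¹ := by
    rw [← Matrix.mul_assoc, Matrix.nonsing_inv_mul _ hdet, Matrix.one_mul]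
  simp only [Matrix.mul_sub, Matrix.sub_mul, Matrix.mul_neg, Matrix.neg_mul, Matrix.mul_add,
    Matrix.add_mul, e1, e2, Matrix.mul_smul, Matrix.smul_mul, Matrix.mul_one, smul_sub, smul_smul]
  abel

/-- A perturbation `E` that is small relative to `S` keeps a definite margin in the Lyapunov
inequality certified by `S`. -/
theorem posSemidef_lyapunov_add {p : ℕ} {S M E : Matrix (Fin p) (Fin p) ℝ} {ε : ℝ}
    (hS : Sᵀ = S) (hM : Mᵀ * S + S * M + (2 : ℝ) • (1 : Matrix (Fin p) (Fin p) ℝ) = 0)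
    (hE : ‖S * E‖ ≤ ε) :
    (-((M + E)ᵀ * S + S * (M + E)) -
      (2 * (1 - ε)) • (1 : Matrix (Fin p) (Fin p) ℝ)).PosSemidef := by
  have h := posSemidef_smul_one_sub_add_transpose (S * E) (mul_le_mul_of_nonneg_left hE two_pos.le)
  convert h using 1
  rw [← sub_eq_zero, ← neg_eq_zero, ← hM, Matrix.transpose_mul, hS, Matrix.transpose_add,
    Matrix.add_mul, Matrix.mul_add, mul_sub, sub_smul, mul_one]
  abel

theorem norm_mul_perturbation_le {p q r : ℕ} {S : Matrix (Fin p) (Fin p) ℝ}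
    {Bu : Matrix (Fin p) (Fin q) ℝ} {Ba : Matrix (Fin p) (Fin r) ℝ}
    {L : Matrix (Fin q) (Fin p) ℝ} {D : Matrix (Fin r) (Fin p) ℝ} {Γ : Matrix (Fin q) (Fin q) ℝ}
    (hΓ : Γ.PosDef) {ε δ : ℝ} (hε : 0 ≤ ε)
    (hD : ‖D‖ ≤ 2 * δ) (hL : Matrix.trace (Lᵀ * Γ * L) ≤ δ ^ 2) (hδ0 : 0 ≤ δ)
    (hδ : δ ≤ ε / 2 * (√(eigMin Γ) / (√(eigMin Γ) * ‖S * Ba‖ + ‖S * Bu‖))) :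
    ‖S * (Bu * L + Ba * D)‖ ≤ ε := by
  have h1 : ‖S * (Bu * L + Ba * D)‖ ≤ ‖S * Bu‖ * ‖L‖ + ‖S * Ba‖ * (2 * δ) := by
    rw [Matrix.mul_add, ← Matrix.mul_assoc, ← Matrix.mul_assoc]
    refine (norm_add_le _ _).trans (add_le_add (Matrix.frobenius_norm_mul _ _) ?_)
    exact (Matrix.frobenius_norm_mul _ _).trans (mul_le_mul_of_nonneg_left hD (norm_nonneg _))
  refine h1.trans ?_
  rcases isEmpty_or_nonempty (Fin q) with hq | hq
  · have hg : eigMin Γ = 0 := by rw [eigMin, dif_pos hΓ.1, Real.iInf_of_isEmpty]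
    have hL0 : ‖L‖ = 0 := by rw [Subsingleton.elim L 0, norm_zero]
    have hδz : δ = 0 := le_antisymm (by simpa [hg] using hδ) hδ0
    simpa [hL0, hδz] using hε
  · have hpos := eigMin_pos hΓ
    have hg : 0 < √(eigMin Γ) := Real.sqrt_pos.2 hpos
    have hgL : √(eigMin Γ) * ‖L‖ ≤ δ := by
      refine le_of_sq_le_sq ?_ hδ0
      rw [mul_pow, Real.sq_sqrt hpos.le]
      exact (mul_norm_sq_le_trace (posSemidef_sub_eigMin hΓ.1) L).trans hL
    generalize √(eigMin Γ) = g at *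
    generalize ha : ‖S * Ba‖ = a at *
    generalize hb : ‖S * Bu‖ = b at *
    have ha0 : 0 ≤ a := ha ▸ norm_nonneg _
    have hb0 : 0 ≤ b := hb ▸ norm_nonneg _
    have hden : 0 ≤ g * a + b := by positivity
    rcases hden.eq_or_lt with h0 | h0
    · have hb' : b = 0 := by nlinarith [mul_nonneg hg.le ha0]
      have ha' : a = 0 := by
        rw [hb', add_zero, eq_comm, mul_eq_zero] at h0
        exact h0.resolve_left hg.ne'
      simpa [ha', hb'] using hε
    · rw [← mul_div_assoc, le_div_iff₀ h0] at hδ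
      refine le_of_mul_le_mul_left ?_ hg
      nlinarith [mul_le_mul_of_nonneg_left hgL hb0, mul_nonneg hb0 hδ0]

/-- Lemma 3, item 2: `P_u(Λ)` and `Π(Λ)` are uniformly bounded on `S₀`. -/
theorem stmt4
    (A : Matrix (Fin n) (Fin n) ℝ) (Bu : Matrix (Fin n) (Fin m_u) ℝ)
    (Ba : Matrix (Fin n) (Fin m_a) ℝ)
    (Q : Matrix (Fin n) (Fin n) ℝ) (R : Matrix (Fin m_a) (Fin m_a) ℝ)
    (Γ : Matrix (Fin m_u) (Fin m_u) ℝ)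
    (hQ : Q.PosDef) (hR : R.PosDef) (hΓ : Γ.PosDef)
    (Kbar : Matrix (Fin m_a) (Fin n) ℝ)
    (Pu Pim : Matrix (Fin m_u) (Fin n) ℝ → Matrix (Fin n) (Fin n) ℝ)
    (hPu : ∀ Λ, (∃ P, IsStabSol A Bu Ba Q R Λ P) → IsStabSol A Bu Ba Q R Λ (Pu Λ))
    (hPim : ∀ Λ, (∃ P, IsStabSol A Bu Ba Q R Λ P) →
      IsLyapSol A Bu Ba R Kbar Λ (Pu Λ) (Pim Λ))
    (h0 : ∃ P, IsStabSol A Bu Ba Q R 0 P)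
    (S : Matrix (Fin n) (Fin n) ℝ) (hS : S.PosDef)
    (hSeq : (A + Ba * (R⁻¹ * Baᵀ * Pu 0))ᵀ * S + S * (A + Ba * (R⁻¹ * Baᵀ * Pu 0))
      + (2 : ℝ) • (1 : Matrix (Fin n) (Fin n) ℝ) = 0)
    (ε : ℝ) (hε0 : 0 < ε) (hε1 : ε < 1)
    (hdist : frobNorm (R⁻¹ * Baᵀ * Pu 0 - Kbar) ≤
      (ε / 2) * (Real.sqrt (eigMin Γ) /
        (Real.sqrt (eigMin Γ) * frobNorm (S * Ba) + frobNorm (S * Bu)))) :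
    ∃ Pbar : ℝ, 0 < Pbar ∧ ∃ Pimbar : ℝ, 0 < Pimbar ∧
      ∀ Λ ∈ S0 A Bu Ba Q R Γ Kbar Pu,
        frobNorm (Pu Λ) ≤ Pbar ∧ frobNorm (Pim Λ) ≤ Pimbar := by
  have hK0 : 0 ≤ ‖R⁻¹ * Baᵀ * Pu 0 - Kbar‖ := norm_nonneg _
  have hSt : Sᵀ = S := hS.1
  have hRt : (R⁻¹)ᵀ = R⁻¹ := hR.inv.1
  have hRdet : IsUnit R.det := (Matrix.isUnit_iff_isUnit_det _).1 hR.isUnit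
  have hη : 0 < 2 * (1 - ε) := by linarith
  obtain ⟨s, hs, hsS⟩ := hS.exists_posSemidef_sub_smul_one
  obtain ⟨s', hs', hsS'⟩ := hS.inv.exists_posSemidef_sub_smul_one
  have hSS : (S⁻¹ * S⁻¹).PosDef := by
    have h := Matrix.PosDef.conjTranspose_mul_self S⁻¹
      (Matrix.mulVec_injective_of_isUnit hS.inv.isUnit)
    rwa [hS.inv.1.eq] at h
  obtain ⟨t, ht, htS⟩ := hSS.exists_posSemidef_sub_smul_one
  simp only [frobNorm_eq_norm] at hdist ⊢
  set δ := ‖R⁻¹ * Baᵀ * Pu 0 - Kbar‖ with hδ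
  set p := ‖S⁻¹‖ ^ 2 * ((δ + ‖Kbar‖) ^ 2 * ‖R‖ + ‖Q‖) / (2 * (1 - ε) * t * s') with hp
  set T := Ba * (R⁻¹ * R⁻¹) * Baᵀ with hT
  set v := 2 * ‖Ba * R⁻¹ * Kbar‖ + 2 * (‖T‖ * p) with hv
  have hp0 : 0 ≤ p := by positivity
  have hv0 : 0 ≤ v := by positivity
  refine ⟨p + 1, by positivity, ‖S‖ ^ 2 * v / (2 * (1 - ε) * s) + 1, by positivity, ?_⟩
  rintro Λ ⟨hex, hJ⟩
  obtain ⟨hPpos, hARE, -⟩ := hPu Λ hex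
  obtain ⟨hPimt, hLyap⟩ := hPim Λ hex
  replace hPimt : (Pim Λ)ᵀ = Pim Λ := hPimt
  have hPt : (Pu Λ)ᵀ = Pu Λ := hPpos.1
  simp only [Jcost, frobNorm_eq_norm, ← hδ, Matrix.transpose_zero, Matrix.zero_mul,
    Matrix.trace_zero, add_zero] at hJ
  set P := Pu Λ
  set K := R⁻¹ * Baᵀ * P with hK
  have htr : 0 ≤ Matrix.trace (Λᵀ * Γ * Λ) := by
    have := (hΓ.posSemidef.conjTranspose_mul_mul_same Λ).trace_nonneg
    rwa [Matrix.conjTranspose_eq_transpose_of_trivial] at this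
  have hKd : ‖K - Kbar‖ ≤ δ := le_of_sq_le_sq (by linarith) hK0
  have hKn : ‖K‖ ≤ δ + ‖Kbar‖ := by
    linarith [norm_sub_norm_le K Kbar]
  have hD : ‖K - R⁻¹ * Baᵀ * Pu 0‖ ≤ 2 * δ := by
    have := norm_sub_le (K - Kbar) (R⁻¹ * Baᵀ * Pu 0 - Kbar)
    rw [sub_sub_sub_cancel_right] at this
    linarith
  have hE := norm_mul_perturbation_le (S := S) hΓ hε0.le hD
    (by linarith [sq_nonneg ‖K - Kbar‖]) hK0 hdist
  have hdiss := posSemidef_lyapunov_add hSt hSeq hE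
  have hM : A + Ba * (R⁻¹ * Baᵀ * Pu 0) + (Bu * Λ + Ba * (K - R⁻¹ * Baᵀ * Pu 0)) =
      A + Bu * Λ + Ba * R⁻¹ * Baᵀ * P := by
    rw [Matrix.mul_sub, hK]
    simp only [Matrix.mul_assoc]
    abel
  rw [hM] at hdiss
  set M := A + Bu * Λ + Ba * R⁻¹ * Baᵀ * P with hMdef
  have hW : Mᵀ * P + P * Mᵀᵀ = Kᵀ * R * K - Q := by
    have hKt : Kᵀ * R * K = P * Ba * R⁻¹ * Baᵀ * P := by
      rw [hK, Matrix.transpose_mul, Matrix.transpose_mul, hPt, hRt, Matrix.transpose_transpose]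
      simp only [Matrix.mul_assoc, Matrix.mul_nonsing_inv_cancel_left _ _ hRdet]
    have hKP : (Ba * R⁻¹ * Baᵀ * P)ᵀ * P = P * Ba * R⁻¹ * Baᵀ * P := by
      simp only [Matrix.transpose_mul, hPt, hRt, Matrix.transpose_transpose, Matrix.mul_assoc]
    have hPK : P * (Ba * R⁻¹ * Baᵀ * P) = P * Ba * R⁻¹ * Baᵀ * P := by
      simp only [Matrix.mul_assoc]
    rw [Matrix.transpose_transpose, hMdef, Matrix.transpose_add, Matrix.add_mul _ _ P,
      Matrix.mul_add P, hKt, hKP, hPK, ← sub_eq_zero, ← hARE]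
    abel
  have hWn : ‖Kᵀ * R * K - Q‖ ≤ (δ + ‖Kbar‖) ^ 2 * ‖R‖ + ‖Q‖ := by
    refine (norm_sub_le _ _).trans (add_le_add_left ?_ _)
    calc ‖Kᵀ * R * K‖ ≤ ‖Kᵀ‖ * ‖R‖ * ‖K‖ :=
          (Matrix.frobenius_norm_mul _ _).trans
            (mul_le_mul_of_nonneg_right (Matrix.frobenius_norm_mul _ _) (norm_nonneg _))
      _ = ‖K‖ ^ 2 * ‖R‖ := by
          rw [Matrix.frobenius_norm_transpose]
          ring
      _ ≤ _ := by gcongr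
  have hPn : ‖P‖ ≤ p := by
    refine (lyapunov_solution_norm_le hs' (mul_pos hη ht) hS.inv.posSemidef hsS'
      (posSemidef_lyapunov_inv hη.le hS htS hdiss) hPt hW).trans ?_
    rw [hp]
    gcongr
  have hV : M * Pim Λ + Pim Λ * Mᵀ =
      (Ba * R⁻¹ * Kbar)ᵀ + Ba * R⁻¹ * Kbar - ((T * P)ᵀ + T * P) := by
    have e1 : (Ba * R⁻¹ * Kbar)ᵀ = Kbarᵀ * R⁻¹ * Baᵀ := by
      simp only [Matrix.transpose_mul, hRt, Matrix.mul_assoc]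
    have e2 : (T * P)ᵀ = P * Ba * (R⁻¹ * R⁻¹) * Baᵀ := by
      simp only [hT, Matrix.transpose_mul, hRt, hPt, Matrix.transpose_transpose, Matrix.mul_assoc]
    rw [e1, e2, ← sub_eq_zero, ← hLyap]
    abel
  have hVn : ‖(Ba * R⁻¹ * Kbar)ᵀ + Ba * R⁻¹ * Kbar - ((T * P)ᵀ + T * P)‖ ≤ v := by
    have h1 := norm_sub_le ((Ba * R⁻¹ * Kbar)ᵀ + Ba * R⁻¹ * Kbar) ((T * P)ᵀ + T * P)
    have h2 := norm_add_le (Ba * R⁻¹ * Kbar)ᵀ (Ba * R⁻¹ * Kbar)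
    have h3 := norm_add_le (T * P)ᵀ (T * P)
    have h4 := (Matrix.frobenius_norm_mul T P).trans
      (mul_le_mul_of_nonneg_left hPn (norm_nonneg T))
    rw [Matrix.frobenius_norm_transpose] at h2 h3
    linarith
  refine ⟨by linarith, ?_⟩
  have hPimn := lyapunov_solution_norm_le hs hη hS.posSemidef hsS hdiss hPimt hV
  have hle : ‖S‖ ^ 2 * ‖(Ba * R⁻¹ * Kbar)ᵀ + Ba * R⁻¹ * Kbar - ((T * P)ᵀ + T * P)‖ /
      (2 * (1 - ε) * s) ≤ ‖S‖ ^ 2 * v / (2 * (1 - ε) * s) := by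
    gcongr
  linarith

end Frobenius
end
end
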